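/- arXiv:math/0104203 — 2 statements merged into one kernel-verified Lean document; each statement's English description precedes it below -/
import Mathlib

section
/- Let $E = \wedge V$ with $\dim V = v$, and let $\mathfrak{m} \subset E$ be the maximal graded ideal generated by $V$. For $0 \le i, j < v$, the space of degree-0 $E$-module homomorphisms $\mathrm{Hom}_E(\omega_E(i)/\mathfrak{m}^{v-i}\omega_E(i),\; \omega_E(j)/\mathfrak{m}^{v-j}\omega_E(j))$ is naturally isomorphic to $\wedge^{i-j} V$ (in particular it vanishes when $i < j$), and composition of homomorphisms corresponds to the wedge product in $\wedge V$. -/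
noncomputable section

variable (K : Type) [Field K] (V : Type) [AddCommGroup V] [Module K V]
  [FiniteDimensional K V]

instance : Module (ExteriorAlgebra K V) (ExteriorAlgebra K V) := Semiring.toModule

/-- `v = dim_K V`. -/
abbrev vdim := Module.finrank K V

/-- `⋀^k V` as a `K`-subspace of `E = ⋀ V`. -/
abbrev lam (k : ℕ) : Submodule K (ExteriorAlgebra K V) := ⋀[K]^k V

/-- The left ideal `𝔪^{v-i}` of `E` (so that `E ⧸ 𝔪^{v-i}` models
`ω_E(i) ⧸ 𝔪^{v-i} ω_E(i)`, the generator of `ω_E(i)` corresponding to `1`). -/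
def NN (i : ℕ) : Submodule (ExteriorAlgebra K V) (ExteriorAlgebra K V) :=
  Submodule.span (ExteriorAlgebra K V) ((lam K V (vdim K V - i)) : Set (ExteriorAlgebra K V))

/-- The model `X_i = E ⧸ 𝔪^{v-i}` of `ω_E(i) ⧸ 𝔪^{v-i} ω_E(i)`. -/
abbrev Xq (i : ℕ) := ExteriorAlgebra K V ⧸ NN K V i

/-- The `k`-th graded level of `X_i`: the image of `⋀^k V`.  (It sits in internal degree
`v - i - k`, matching the grading of `ω_E(i) ⧸ 𝔪^{v-i}ω_E(i)`.) -/
def gradeX (i k : ℕ) : Submodule K (Xq K V i) :=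
  Submodule.map (((NN K V i).mkQ).restrictScalars K) (lam K V k)

/-- The space of degree-zero `E`-module homomorphisms
`ω_E(i)/𝔪^{v-i}ω_E(i) → ω_E(j)/𝔪^{v-j}ω_E(j)`: those `E`-linear maps `X_i → X_j` sending
each graded level of `X_i` into the graded level of `X_j` of the same internal degree. -/
def Hom0 (i j : ℕ) : Submodule K (Xq K V i →ₗ[ExteriorAlgebra K V] Xq K V j) where
  carrier := {f |
    (∀ k l : ℕ, (l : ℤ) = (k : ℤ) + i - j → ∀ y ∈ gradeX K V i k, f y ∈ gradeX K V j l) ∧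
    (∀ k : ℕ, ((k : ℤ) + i - j < 0) → ∀ y ∈ gradeX K V i k, f y = 0)}
  add_mem' := by
    intro f g hf hg
    refine ⟨fun k l hl y hy => ?_, fun k hk y hy => ?_⟩
    · simpa using Submodule.add_mem _ (hf.1 k l hl y hy) (hg.1 k l hl y hy)
    · simp [LinearMap.add_apply, hf.2 k hk y hy, hg.2 k hk y hy]
  zero_mem' := by
    refine ⟨fun k l hl y hy => ?_, fun k hk y hy => ?_⟩ <;> simp
  smul_mem' := by
    intro c f hf
    refine ⟨fun k l hl y hy => ?_, fun k hk y hy => ?_⟩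
    · simpa using Submodule.smul_mem _ c (hf.1 k l hl y hy)
    · simp [LinearMap.smul_apply, hf.2 k hk y hy]

lemma NN_proj (i : ℕ) (x : ExteriorAlgebra K V) (hx : x ∈ NN K V i) :
    ∀ n : ℕ, n < vdim K V - i →
      (DirectSum.decompose (fun n : ℕ => ⋀[K]^n V) x n : ExteriorAlgebra K V) = 0 := by
  unfold NN at hx
  induction hx using Submodule.span_induction with
  | mem x h =>
    intro n hn
    exact DirectSum.decompose_of_mem_ne (fun n : ℕ => ⋀[K]^n V) h (by omega)
  | zero => intro n hn; simp
  | add x y _ _ hx hy =>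
    intro n hn
    rw [DirectSum.decompose_add, DirectSum.add_apply, Submodule.coe_add, hx n hn, hy n hn,
      add_zero]
  | smul a x _ hx =>
    induction a using DirectSum.Decomposition.inductionOn (fun n : ℕ => ⋀[K]^n V) with
    | zero => intro n hn; simp
    | @homogeneous m a =>
      intro n hn
      rw [smul_eq_mul, DirectSum.coe_decompose_mul_of_left_mem (fun n : ℕ => ⋀[K]^n V) n a.2]
      split_ifs with h
      · rw [hx (n - m) (by omega), mul_zero]
      · rfl
    | add a b ha hb =>
      intro n hn
      rw [add_smul, DirectSum.decompose_add, DirectSum.add_apply, Submodule.coe_add, ha n hn,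
        hb n hn, add_zero]

lemma lam_NN (i n : ℕ) (hn : n < vdim K V - i) (x : ExteriorAlgebra K V) (h : x ∈ lam K V n)
    (hx : x ∈ NN K V i) : x = 0 := by
  have := NN_proj K V i x hx n hn
  rwa [DirectSum.decompose_of_mem_same (fun n : ℕ => ⋀[K]^n V) h] at this

lemma NN_mul (i j : ℕ) (hj : j ≤ i) (hi : i < vdim K V) (a : ExteriorAlgebra K V)
    (ha : a ∈ lam K V (i - j)) :
    NN K V i ≤ LinearMap.ker ((NN K V j).mkQ ∘ₗ
      LinearMap.toSpanSingleton (ExteriorAlgebra K V) (ExteriorAlgebra K V) a) := by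
  unfold NN
  rw [Submodule.span_le]
  intro x hx
  simp only [SetLike.mem_coe, LinearMap.mem_ker, LinearMap.comp_apply,
    LinearMap.toSpanSingleton_apply, Submodule.mkQ_apply, Submodule.Quotient.mk_eq_zero]
  apply Submodule.subset_span
  have := SetLike.mul_mem_graded (A := fun n : ℕ => ⋀[K]^n V) hx ha
  rw [show vdim K V - i + (i - j) = vdim K V - j by omega] at this
  exact this

def mulHom (i j : ℕ) (hj : j ≤ i) (hi : i < vdim K V) (a : lam K V (i - j)) :
    Xq K V i →ₗ[ExteriorAlgebra K V] Xq K V j :=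
  (NN K V i).liftQ _ (NN_mul K V i j hj hi a a.2)

lemma mulHom_mk (i j : ℕ) (hj : j ≤ i) (hi : i < vdim K V) (a : lam K V (i - j))
    (x : ExteriorAlgebra K V) :
    mulHom K V i j hj hi a ((NN K V i).mkQ x) =
      (NN K V j).mkQ (x * (a : ExteriorAlgebra K V)) := rfl

lemma Xq_ext (i j : ℕ) (f g : Xq K V i →ₗ[ExteriorAlgebra K V] Xq K V j)
    (h : f ((NN K V i).mkQ 1) = g ((NN K V i).mkQ 1)) : f = g := by
  apply Submodule.linearMap_qext
  apply LinearMap.ext_ring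
  exact h

lemma one_gradeX (i : ℕ) : (NN K V i).mkQ 1 ∈ gradeX K V i 0 :=
  ⟨1, SetLike.one_mem_graded (fun n : ℕ => ⋀[K]^n V), rfl⟩

def mulHom0 (i j : ℕ) (hj : j ≤ i) (hi : i < vdim K V) :
    lam K V (i - j) →ₗ[K] Hom0 K V i j where
  toFun a := ⟨mulHom K V i j hj hi a, by
    refine ⟨fun k l hl y hy => ?_, fun k hk y hy => by omega⟩
    obtain ⟨x, hx, rfl⟩ := hy
    have := SetLike.mul_mem_graded (A := fun n : ℕ => ⋀[K]^n V) hx a.2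
    rw [show k + (i - j) = l by omega] at this
    exact ⟨_, this, rfl⟩⟩
  map_add' a b := by
    apply Subtype.ext
    apply Xq_ext
    simp only [Submodule.coe_add, LinearMap.add_apply, mulHom_mk, one_mul, map_add]
  map_smul' c a := by
    apply Subtype.ext
    apply Xq_ext
    simp only [Submodule.coe_smul, LinearMap.smul_apply, mulHom_mk, one_mul, RingHom.id_apply]
    rfl

lemma mulHom0_bij (i j : ℕ) (hj : j ≤ i) (hi : i < vdim K V) :
    Function.Bijective (mulHom0 K V i j hj hi) := by
  constructor
  · rw [injective_iff_map_eq_zero]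
    intro a ha
    have h1 : mulHom K V i j hj hi a ((NN K V i).mkQ 1) = 0 := by
      have : mulHom K V i j hj hi a = 0 := congrArg Subtype.val ha
      rw [this]; rfl
    rw [mulHom_mk, one_mul, Submodule.mkQ_apply, Submodule.Quotient.mk_eq_zero] at h1
    exact Subtype.ext (lam_NN K V j (i - j) (by omega) a a.2 h1)
  · intro f
    obtain ⟨a, ha, h⟩ := f.2.1 0 (i - j) (by omega) _ (one_gradeX K V i)
    refine ⟨⟨a, ha⟩, Subtype.ext (Xq_ext K V i j _ _ ?_)⟩
    rw [← h]
    change mulHom K V i j hj hi _ _ = _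
    rw [mulHom_mk, one_mul]
    rfl

def PhiE (i j : ℕ) (hj : j ≤ i) (hi : i < vdim K V) :
    Hom0 K V i j ≃ₗ[K] lam K V (i - j) :=
  (LinearEquiv.ofBijective _ (mulHom0_bij K V i j hj hi)).symm

lemma PhiE_spec (i j : ℕ) (hj : j ≤ i) (hi : i < vdim K V) (f : Hom0 K V i j)
    (x : ExteriorAlgebra K V) :
    f.1 ((NN K V i).mkQ x) =
      (NN K V j).mkQ (x * (PhiE K V i j hj hi f : ExteriorAlgebra K V)) := by
  have : mulHom0 K V i j hj hi (PhiE K V i j hj hi f) = f :=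
    (LinearEquiv.ofBijective _ (mulHom0_bij K V i j hj hi)).apply_symm_apply f
  rw [← mulHom_mk K V i j hj hi]
  exact congrArg (fun g : Hom0 K V i j => g.1 ((NN K V i).mkQ x)) this.symm

/-!
STATEMENT 7: For `0 ≤ i, j < v`, the space of degree-zero `E`-module homomorphisms
`Hom_E(ω_E(i)/𝔪^{v-i}ω_E(i), ω_E(j)/𝔪^{v-j}ω_E(j))` is naturally isomorphic to `⋀^{i-j} V`
(in particular it vanishes for `i < j`), and composition of homomorphisms corresponds to
the wedge product in `⋀ V`.
-/
theorem stmt_7 :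
    ∃ Φ : ∀ i j : ℕ, j ≤ i → i < vdim K V → (↥(Hom0 K V i j) ≃ₗ[K] ↥(lam K V (i - j))),
      (∀ i j : ℕ, i < j → j < vdim K V → Subsingleton (↥(Hom0 K V i j))) ∧
      (∀ (i j k : ℕ) (hk : k ≤ j) (hj : j ≤ i) (hi : i < vdim K V)
          (f : ↥(Hom0 K V i j)) (g : ↥(Hom0 K V j k)),
        ((g : Xq K V j →ₗ[ExteriorAlgebra K V] Xq K V k) ∘ₗ
            (f : Xq K V i →ₗ[ExteriorAlgebra K V] Xq K V j)) ∈ Hom0 K V i k ∧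
        ∀ h : ((g : Xq K V j →ₗ[ExteriorAlgebra K V] Xq K V k) ∘ₗ
            (f : Xq K V i →ₗ[ExteriorAlgebra K V] Xq K V j)) ∈ Hom0 K V i k,
          (↑(Φ i k (hk.trans hj) hi ⟨_, h⟩) : ExteriorAlgebra K V) =
            ↑(Φ i j hj hi f) * ↑(Φ j k hk (lt_of_le_of_lt hj hi) g)) := by
  refine ⟨PhiE K V, fun i j hij hj => ⟨fun f g => ?_⟩, fun i j k hk hj hi f g => ⟨?_, ?_⟩⟩
  · apply Subtype.ext
    apply Xq_ext
    rw [f.2.2 0 (by omega) _ (one_gradeX K V i), g.2.2 0 (by omega) _ (one_gradeX K V i)]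
  · refine ⟨fun m l hl y hy => ?_, fun m hm y hy => by omega⟩
    exact g.2.1 (m + (i - j)) l (by omega) _ (f.2.1 m (m + (i - j)) (by omega) y hy)
  · intro h
    have hi' := lt_of_le_of_lt hj hi
    have e := PhiE_spec K V i k (hk.trans hj) hi ⟨_, h⟩ 1
    change g.1 (f.1 _) = _ at e
    rw [PhiE_spec K V i j hj hi f, PhiE_spec K V j k hk hi' g, one_mul, one_mul, ← sub_eq_zero,
      ← map_sub, Submodule.mkQ_apply, Submodule.Quotient.mk_eq_zero] at e
    have hm := SetLike.mul_mem_graded (A := fun n : ℕ => ⋀[K]^n V)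
      (PhiE K V i j hj hi f).2 (PhiE K V j k hk hi' g).2
    rw [show i - j + (j - k) = i - k by omega] at hm
    exact (sub_eq_zero.1 (lam_NN K V k (i - k) (by omega) _
      (Submodule.sub_mem _ hm (PhiE K V i k (hk.trans hj) hi ⟨_, h⟩).2) e)).symm

end
end

section
/- Let $E = \wedge V$ with $\dim_K V = v$ and let $\mathfrak{m}$ be its maximal graded ideal. For $i > 0$, the minimal free resolution of $\mathfrak{m}^i$ over $E$ has $\ell$-th term $E \otimes_K (\wedge^i_{\ell+1} W)^*$, where $\wedge^i_j(W) = \mathrm{im}(\wedge^i W \otimes_K \mathrm{Sym}_{j-1} W \to \wedge^{i-1} W \otimes_K \mathrm{Sym}_j W)$ is the hook Schur module. -/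
open scoped TensorProduct

set_option maxSynthPendingDepth 3
set_option synthInstance.maxHeartbeats 1000000

noncomputable section

variable (K : Type) [Field K] (v : ℕ)

/-- Homogeneous polynomials of degree `q`: `Sym_q W` for the `v`-dimensional space `W`. -/
abbrev Symq (q : ℕ) := ↥(MvPolynomial.homogeneousSubmodule (Fin v) K q)

/-- `W = Sym_1 W`. -/
abbrev Wlin := Symq K v 1

/-- `V = W^*`, so that `E = ⋀ V` is the Koszul dual exterior algebra. -/
abbrev Vdu := Module.Dual K (Wlin K v)

/-- The exterior algebra `E = ⋀ V`. -/
abbrev ExtE := ExteriorAlgebra K (Vdu K v)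

instance : Module (ExtE K v) (ExtE K v) := Semiring.toModule

/-- The decomposable element `w₁ ∧ ⋯ ∧ wₙ ∈ ⋀ⁿ W`. -/
def wedgeEl (n : ℕ) (w : Fin n → Wlin K v) : ↥(⋀[K]^n (Wlin K v)) :=
  ⟨ExteriorAlgebra.ιMulti K n w, ExteriorAlgebra.ιMulti_range K n (Set.mem_range_self w)⟩

/-- Multiplication `Sym_1 W ⊗ Sym_q W → Sym_{q+1} W`. -/
def symMul {q : ℕ} (w : Wlin K v) (s : Symq K v q) : Symq K v (q + 1) :=
  ⟨(w : MvPolynomial (Fin v) K) * (s : MvPolynomial (Fin v) K), by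
    have hw := (MvPolynomial.mem_homogeneousSubmodule _ _).1 w.2
    have hs := (MvPolynomial.mem_homogeneousSubmodule _ _).1 s.2
    exact (MvPolynomial.mem_homogeneousSubmodule _ _).2 (by
      simpa [add_comm] using hw.mul hs)⟩

/-- The power `𝔪^i` of the maximal graded ideal `𝔪 = (V) ⊆ E`, as a left ideal. -/
def mPow (i : ℕ) : Submodule (ExtE K v) (ExtE K v) :=
  Submodule.span (ExtE K v) ((⋀[K]^i (Vdu K v) : Submodule K (ExtE K v)) : Set (ExtE K v))

/-- The `K`-subspace `𝔪 · N` of an `E`-module `N`. -/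
def mSmul (N : Type) [AddCommGroup N] [Module K N] [Module (ExtE K v) N] :
    Submodule K N :=
  Submodule.span K {z : N | ∃ (u : ExtE K v) (y : N),
    u ∈ (⨆ k : ℕ, (⋀[K]^(k+1) (Vdu K v) : Submodule K (ExtE K v))) ∧ z = u • y}


theorem hk_comm {A : Type*} [Ring A] (x D h : A) (h1 : x * D = -(D * x)) (h2 : x * h = -(h * x)) :
    x * (1 - D * h - h * D) = (1 - D * h - h * D) * x := by
  have e1 : x * (D * h) = D * h * x := by
    rw [← mul_assoc, h1, neg_mul, mul_assoc, h2]; simp [mul_assoc]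
  have e2 : x * (h * D) = h * D * x := by
    rw [← mul_assoc, h2, neg_mul, mul_assoc, h1]; simp [mul_assoc]
  simp only [mul_sub, sub_mul, e1, e2, mul_one, one_mul]

theorem hk_homotopy {A ι : Type*} [Ring A] (D h : ι → A)
    (hDD : ∀ a b, D a * D b = -(D b * D a)) (hD2 : ∀ a, D a * D a = 0)
    (hDh : ∀ a b, a ≠ b → D a * h b = -(h b * D a))
    (hDhD : ∀ a, D a * h a * D a = D a) (l : List ι) (nd : l.Nodup) :
    ∃ H : A, (∀ x, (∀ a ∈ l, x * D a = -(D a * x) ∧ x * h a = -(h a * x)) → x * H = -(H * x)) ∧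
      (l.map D).sum * H + H * (l.map D).sum
        = 1 - (l.map (fun a => 1 - D a * h a - h a * D a)).prod := by
  induction l with
  | nil => exact ⟨0, by simp, by simp⟩
  | cons a l ih =>
    obtain ⟨H, hH, hE⟩ := ih (List.nodup_cons.1 nd).2
    have hal := (List.nodup_cons.1 nd).1
    set P := 1 - D a * h a - h a * D a with hP
    refine ⟨h a + P * H, ?_, ?_⟩
    · intro x hx
      have h1 := hx a (by simp)
      have h2 := hH x (fun b hb => hx b (by simp [hb]))
      have h3 := hk_comm x _ _ h1.1 h1.2
      rw [← hP] at h3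
      rw [mul_add, ← mul_assoc, h3, mul_assoc, h2, h1.2]
      noncomm_ring
    · have k1 : D a * P = 0 := by
        rw [hP, mul_sub, mul_sub, ← mul_assoc, ← mul_assoc, hD2, hDhD]; simp
      have k2 : P * D a = 0 := by
        rw [hP, sub_mul, sub_mul, hDhD, mul_assoc, hD2]; simp
      have k3 : D a * H = -(H * D a) := hH _ (fun b hb =>
        ⟨hDD a b, hDh a b (fun e => hal (e ▸ hb))⟩)
      have k4 : ∀ b ∈ l, D b * P = P * D b := fun b hb =>
        hk_comm _ _ _ (hDD b a) (hDh b a (fun e => hal (e ▸ hb)))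
      have k5 : (l.map D).sum * P = P * (l.map D).sum := by
        rw [← List.sum_map_mul_right, ← List.sum_map_mul_left]
        congr 1
        exact List.map_congr_left k4
      have k6 : (l.map D).sum * h a = -(h a * (l.map D).sum) := by
        rw [← List.sum_map_mul_right, ← List.sum_map_mul_left, List.map_congr_left
          (fun b hb => hDh b a (fun e => hal (e ▸ hb)) : ∀ b ∈ l, D b * h a = -(h a * D b))]
        clear * -
        induction l with
        | nil => simp
        | cons b l ih => simp [ih]; abel
      simp only [List.map_cons, List.sum_cons, List.prod_cons]
      set S := (l.map D).sum
      set Q := (l.map (fun a => 1 - D a * h a - h a * D a)).prod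
      have e1 : H * D a = - (D a * H) := by rw [k3]; simp
      calc (D a + S) * (h a + P * H) + (h a + P * H) * (D a + S)
          = (D a * h a + h a * D a) + (S * h a + h a * S) + (D a * P) * H + P * (H * D a)
            + (S * P * H + P * (H * S)) := by noncomm_ring
        _ = (1 - P) + P * (S * H + H * S) := by
            have e2 : D a * h a + h a * D a = 1 - P := by rw [hP]; noncomm_ring
            rw [k1, e1, k5, k6, e2]
            rw [mul_neg, ← mul_assoc, k2]; noncomm_ring
        _ = 1 - P * Q := by rw [hE]; noncomm_ring

theorem hk_kill {A ι : Type*} [Ring A] (π : ι → A) (y : A) (b : ι) (hb : y * π b = 0)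
    (hc : ∀ a, a ≠ b → y * π a = π a * y) (l : List ι) (hl : b ∈ l) : y * (l.map π).prod = 0 := by
  classical
  induction l with
  | nil => simp at hl
  | cons a l ih =>
    by_cases h : a = b
    · subst h; simp [← mul_assoc, hb]
    · have : b ∈ l := by
        rcases List.mem_cons.1 hl with h' | h'
        · exact absurd h'.symm h
        · exact h'
      simp only [List.map_cons, List.prod_cons]
      rw [← mul_assoc, hc a h, mul_assoc, ih this, mul_zero]

section hkPoly
variable {k : Type*} [Field k] {n : ℕ}

/-- Multiplication by a variable. -/
def hkX (a : Fin n) : MvPolynomial (Fin n) k →ₗ[k] MvPolynomial (Fin n) k :=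
  LinearMap.mulLeft k (MvPolynomial.X a)

/-- Division by a variable. -/
def hkY (a : Fin n) : MvPolynomial (Fin n) k →ₗ[k] MvPolynomial (Fin n) k where
  toFun p := MvPolynomial.divMonomial p (Finsupp.single a 1)
  map_add' x y := MvPolynomial.add_divMonomial x y _
  map_smul' c x := by
    ext m; simp [MvPolynomial.coeff_divMonomial]

theorem hkYX (a : Fin n) (p : MvPolynomial (Fin n) k) : hkY a (hkX a p) = p := by
  simp [hkY, hkX]

theorem hkXX (a b : Fin n) (p : MvPolynomial (Fin n) k) : hkX a (hkX b p) = hkX b (hkX a p) := by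
  simp [hkX]; ring

theorem hkYX' (a b : Fin n) (hab : a ≠ b) (p : MvPolynomial (Fin n) k) :
    hkY a (hkX b p) = hkX b (hkY a p) := by
  classical
  ext m
  simp only [hkY, hkX, LinearMap.coe_mk, AddHom.coe_mk, LinearMap.mulLeft_apply,
    MvPolynomial.coeff_divMonomial, MvPolynomial.coeff_X_mul']
  have h1 : b ∈ (Finsupp.single a 1 + m).support ↔ b ∈ m.support := by
    simp [Finsupp.single_apply, hab]
  simp only [h1]
  split_ifs with h
  · congr 1
    ext c
    by_cases hcb : c = b
    · subst hcb; simp [Finsupp.single_apply, hab]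
    · simp [Finsupp.single_apply, Ne.symm hcb]
  · rfl

/-- The main contracting homotopy. -/
theorem hk_main {F : Type*} [AddCommGroup F] [Module k F] (c c' : Fin n → F →ₗ[k] F)
    (hcc : ∀ a b x, c a (c b x) = -(c b (c a x))) (hc2 : ∀ a x, c a (c a x) = 0)
    (hcc' : ∀ a b, a ≠ b → ∀ x, c a (c' b x) = -(c' b (c a x)))
    (h1 : ∀ a x, c a (c' a x) + c' a (c a x) = x)
    (hcc'' : ∀ a b x, c' a (c' b x) = -(c' b (c' a x))) (hc2' : ∀ a x, c' a (c' a x) = 0)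
    (f : MvPolynomial (Fin n) k →ₗ[k] F) (hf : ∀ s, ∑ a, c a (f (MvPolynomial.X a * s)) = 0) :
    ∃ g r : MvPolynomial (Fin n) k →ₗ[k] F,
      (∀ s, f s = ∑ a, c a (g (MvPolynomial.X a * s)) + r s) ∧
      (∀ b s, r (MvPolynomial.X b * s) = 0) ∧ (∀ b s, c' b (r s) = 0) := by
  let D : Fin n → Module.End k (MvPolynomial (Fin n) k →ₗ[k] F) := fun a =>
    (LinearMap.llcomp k _ _ _ (c a)) ∘ₗ LinearMap.lcomp k F (hkX a)
  let h : Fin n → Module.End k (MvPolynomial (Fin n) k →ₗ[k] F) := fun a =>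
    (LinearMap.llcomp k _ _ _ (c' a)) ∘ₗ LinearMap.lcomp k F (hkY a)
  have hD : ∀ a f s, D a f s = c a (f (hkX a s)) := fun _ _ _ => rfl
  have hh : ∀ a f s, h a f s = c' a (f (hkY a s)) := fun _ _ _ => rfl
  have e1 : ∀ a x, c a (c' a (c a x)) = c a x := fun a x => by
    have := h1 a (c a x); rwa [hc2, map_zero, add_zero] at this
  obtain ⟨H, -, hE⟩ := hk_homotopy D h
    (fun a b => by refine LinearMap.ext fun f => LinearMap.ext fun s => ?_; simp [hD, hkXX a b, hcc a b])
    (fun a => by refine LinearMap.ext fun f => LinearMap.ext fun s => ?_; simp [hD, hc2])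
    (fun a b hab => by
      refine LinearMap.ext fun f => LinearMap.ext fun s => ?_
      simp only [Module.End.mul_apply, LinearMap.neg_apply, hD, hh, hcc' a b hab,
        hkYX' b a hab.symm])
    (fun a => by refine LinearMap.ext fun f => LinearMap.ext fun s => ?_; simp only [Module.End.mul_apply, hD, hh, hkYX, e1])
    (List.finRange n) (List.nodup_finRange n)
  set π := fun a => 1 - D a * h a - h a * D a with hπ
  have hπ' : ∀ a f s, π a f s = c' a (c a (f (s - hkX a (hkY a s)))) := fun a f s => by
    have := h1 a (f s)
    simp only [hπ, LinearMap.sub_apply, Module.End.mul_apply, Module.End.one_apply, hD, hh, hkYX,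
      map_sub]
    rw [eq_sub_of_add_eq' this]
  have hsum : ∀ f s, ((List.finRange n).map D).sum f s = ∑ a, c a (f (MvPolynomial.X a * s)) := by
    intro f s
    rw [← List.ofFn_eq_map, List.sum_ofFn, LinearMap.sum_apply, LinearMap.sum_apply]
    rfl
  have key := fun s => LinearMap.congr_fun (LinearMap.congr_fun hE f) s
  have hDf : ((List.finRange n).map D).sum f = 0 := by
    refine LinearMap.ext fun s => ?_
    rw [hsum, hf]; rfl
  refine ⟨H f, ((List.finRange n).map π).prod f, ?_, ?_, ?_⟩
  · intro s
    have := key s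
    simp only [LinearMap.add_apply, Module.End.mul_apply, LinearMap.sub_apply, Module.End.one_apply,
      hDf, map_zero, hsum, LinearMap.zero_apply, add_zero] at this
    rw [this]; abel
  · intro b s
    have := hk_kill π (LinearMap.lcomp k F (hkX b)) b
      (by
        refine LinearMap.ext fun f => LinearMap.ext fun s => ?_
        simp only [Module.End.mul_apply, LinearMap.lcomp_apply, hπ', hkYX, sub_self, map_zero]
        rfl)
      (fun a hab => by
        refine LinearMap.ext fun f => LinearMap.ext fun s => ?_
        simp only [Module.End.mul_apply, LinearMap.lcomp_apply, hπ', hkYX' a b hab, map_sub]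
        rw [hkXX a b]) (List.finRange n) (List.mem_finRange b)
    exact LinearMap.congr_fun (LinearMap.congr_fun this f) s
  · intro b s
    have := hk_kill π (LinearMap.llcomp k _ _ _ (c' b)) b
      (by
        refine LinearMap.ext fun f => LinearMap.ext fun s => ?_
        simp only [Module.End.mul_apply, LinearMap.llcomp_apply, hπ', hc2']
        rfl)
      (fun a hab => by
        refine LinearMap.ext fun f => LinearMap.ext fun s => ?_
        simp only [Module.End.mul_apply, LinearMap.llcomp_apply, hπ']
        rw [hcc'' b a, hcc' a b hab]; simp) (List.finRange n) (List.mem_finRange b)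
    exact LinearMap.congr_fun (LinearMap.congr_fun this f) s
end hkPoly

section hkExt
variable {k M : Type*} [Field k] [AddCommGroup M] [Module k M]

/-- Left contraction. -/
def hkcL (d : Module.Dual k M) : ExteriorAlgebra k M →ₗ[k] ExteriorAlgebra k M :=
  CliffordAlgebra.contractLeft (Q := (0 : QuadraticForm k M)) d

/-- Right contraction. -/
def hkcR (d : Module.Dual k M) : ExteriorAlgebra k M →ₗ[k] ExteriorAlgebra k M :=
  (CliffordAlgebra.contractRight (Q := (0 : QuadraticForm k M))).flip d

theorem hkcL_mul (d : Module.Dual k M) (m : M) (b : ExteriorAlgebra k M) :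
    hkcL d (ExteriorAlgebra.ι k m * b) = d m • b - ExteriorAlgebra.ι k m * hkcL d b :=
  CliffordAlgebra.contractLeft_ι_mul _ _ _

theorem hkcR_mul (d : Module.Dual k M) (m : M) (b : ExteriorAlgebra k M) :
    hkcR d (b * ExteriorAlgebra.ι k m) = d m • b - hkcR d b * ExteriorAlgebra.ι k m :=
  CliffordAlgebra.contractRight_mul_ι _ _ _

theorem hkcL_alg (d : Module.Dual k M) (r : k) :
    hkcL d (algebraMap k _ r) = 0 :=
  CliffordAlgebra.contractLeft_algebraMap _ _ _

theorem hkcL_sq (d : Module.Dual k M) (b : ExteriorAlgebra k M) : hkcL d (hkcL d b) = 0 :=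
  CliffordAlgebra.contractLeft_contractLeft _ _

theorem hkcR_sq (d : Module.Dual k M) (b : ExteriorAlgebra k M) : hkcR d (hkcR d b) = 0 :=
  CliffordAlgebra.contractRight_contractRight _ _

theorem hkcL_comm (d d' : Module.Dual k M) (b : ExteriorAlgebra k M) :
    hkcL d (hkcL d' b) = -(hkcL d' (hkcL d b)) :=
  CliffordAlgebra.contractLeft_comm _ _ _

theorem hkcR_comm (d d' : Module.Dual k M) (b : ExteriorAlgebra k M) :
    hkcR d (hkcR d' b) = -(hkcR d' (hkcR d b)) :=
  CliffordAlgebra.contractRight_comm _ _ _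

theorem hk_ι_anti (x y : M) : ExteriorAlgebra.ι k x * ExteriorAlgebra.ι k y
    = -(ExteriorAlgebra.ι k y * ExteriorAlgebra.ι k x) :=
  eq_neg_of_add_eq_zero_left (ExteriorAlgebra.ι_add_mul_swap x y)

theorem hkcL_ιMulti (d : Module.Dual k M) (p : ℕ) (w : Fin (p+1) → M) :
    hkcL d (ExteriorAlgebra.ιMulti k (p+1) w) =
      ∑ j : Fin (p+1), ((-1 : k)^(j : ℕ)) • d (w j) •
        ExteriorAlgebra.ιMulti k p (fun i => w (j.succAbove i)) := by
  induction p with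
  | zero =>
    rw [ExteriorAlgebra.ιMulti_succ_apply, hkcL_mul, ExteriorAlgebra.ιMulti_zero_apply]
    have := hkcL_alg d (1 : k)
    rw [map_one] at this
    simp [this]
  | succ p ih =>
    rw [ExteriorAlgebra.ιMulti_succ_apply, hkcL_mul, ih, Finset.mul_sum, Fin.sum_univ_succ (n := p + 1),
      sub_eq_add_neg, ← Finset.sum_neg_distrib]
    congr 1
    · simp [Matrix.vecTail, Function.comp_def]
    · refine Finset.sum_congr rfl fun j _ => ?_
      rw [ExteriorAlgebra.ιMulti_succ_apply]
      simp only [Matrix.vecTail, Function.comp_def, mul_smul_comm, Fin.val_succ, pow_succ,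
        Fin.succ_succAbove_zero, Fin.succ_succAbove_succ]
      simp

theorem hkcL_mem (d : Module.Dual k M) (p : ℕ) (w : ExteriorAlgebra k M) (hw : w ∈ ⋀[k]^(p+1) M) :
    hkcL d w ∈ ⋀[k]^p M := by
  rw [← ExteriorAlgebra.ιMulti_span_fixedDegree] at hw
  induction hw using Submodule.span_induction with
  | mem x hx =>
    obtain ⟨w, rfl⟩ := hx
    rw [hkcL_ιMulti]
    refine Submodule.sum_mem _ fun j _ => Submodule.smul_mem _ _ (Submodule.smul_mem _ _ ?_)
    exact ExteriorAlgebra.ιMulti_range k p (Set.mem_range_self _)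
  | zero => simp
  | add x y _ _ hx hy => rw [map_add]; exact add_mem hx hy
  | smul c x _ hx => rw [map_smul]; exact Submodule.smul_mem _ _ hx

/-- contraction on exterior powers -/
def hkcr (d : Module.Dual k M) (p : ℕ) : ↥(⋀[k]^(p+1) M) →ₗ[k] ↥(⋀[k]^p M) :=
  (hkcL d).restrict (hkcL_mem d p)

/-- projection to exterior powers -/
def hkprE (p : ℕ) : ExteriorAlgebra k M →ₗ[k] ↥(⋀[k]^p M) :=
  DirectSum.component k ℕ (fun i => ↥(⋀[k]^i M)) p ∘ₗ
    (DirectSum.decomposeLinearEquiv (fun i : ℕ => ⋀[k]^i M)).toLinearMap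

theorem hkprE_same (p : ℕ) (w : ↥(⋀[k]^p M)) : hkprE p (w : ExteriorAlgebra k M) = w := by
  change DirectSum.decompose (fun i : ℕ => ⋀[k]^i M) (w : ExteriorAlgebra k M) p = w
  rw [DirectSum.decompose_coe, DirectSum.of_eq_same]

theorem hkprE_ne (p q : ℕ) (h : q ≠ p) (w : ↥(⋀[k]^q M)) :
    hkprE p (w : ExteriorAlgebra k M) = 0 := by
  change DirectSum.decompose (fun i : ℕ => ⋀[k]^i M) (w : ExteriorAlgebra k M) p = 0
  rw [DirectSum.decompose_coe, DirectSum.of_eq_of_ne _ _ _ h.symm]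

theorem hkprE_cL (d : Module.Dual k M) (p : ℕ) (w : ExteriorAlgebra k M) :
    hkprE p (hkcL d w) = hkcr d p (hkprE (p+1) w) := by
  induction w using DirectSum.Decomposition.inductionOn (fun i : ℕ => ⋀[k]^i M) with
  | zero => simp
  | add x y hx hy => simp [hx, hy]
  | @homogeneous q w =>
    rcases q with _ | q
    · have : hkcL d (w : ExteriorAlgebra k M) = 0 := by
        have hw : (w : ExteriorAlgebra k M) ∈ (1 : Submodule k (ExteriorAlgebra k M)) := by
          have : (w : ExteriorAlgebra k M) ∈ (LinearMap.range (ExteriorAlgebra.ι k (M := M))) ^ 0 := w.2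
          rwa [pow_zero] at this
        obtain ⟨r, hr⟩ := Submodule.mem_one.1 hw
        rw [← hr, hkcL_alg]
      rw [this, hkprE_ne _ _ (by omega)]; simp
    · have e : hkcL d (w : ExteriorAlgebra k M) = (hkcr d q w : ExteriorAlgebra k M) := rfl
      rw [e]
      by_cases h : q = p
      · subst h; rw [hkprE_same, hkprE_same]
      · rw [hkprE_ne _ _ h, hkprE_ne _ _ (by omega), map_zero]
end hkExt

section hkConc
open MvPolynomial

/-- the variable as an element of W -/
def xW (a : Fin v) : Wlin K v := ⟨X a, (mem_homogeneousSubmodule _ _).2 (isHomogeneous_X K a)⟩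

/-- the dual basis -/
def eV (a : Fin v) : Vdu K v := lcoeff K (Finsupp.single a 1) ∘ₗ Submodule.subtype _

theorem eV_xW (a b : Fin v) : eV K v a (xW K v b) = if a = b then 1 else 0 := by
  classical
  simp only [eV, xW, LinearMap.comp_apply, Submodule.subtype_apply, lcoeff_apply, coeff_X']
  simp [Finsupp.single_left_inj, eq_comm]

theorem hk_expand (w : Wlin K v) : w = ∑ a, eV K v a w • xW K v a := by
  have h : ∀ p ∈ Submodule.span K (Set.range (X : Fin v → MvPolynomial (Fin v) K)),
      p = ∑ a, coeff (Finsupp.single a 1) p • X a := by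
    intro p hp
    induction hp using Submodule.span_induction with
    | mem x hx =>
      obtain ⟨b, rfl⟩ := hx
      classical
      simp [coeff_X', Finsupp.single_left_inj]
    | zero => simp
    | add x y _ _ hx hy =>
      conv_lhs => rw [hx, hy]
      simp [add_smul, Finset.sum_add_distrib]
    | smul c x _ hx =>
      conv_lhs => rw [hx]
      simp [Finset.smul_sum, smul_smul]
  have h2 := h w (by rw [← homogeneousSubmodule_one_eq_span_X]; exact w.2)
  apply Subtype.ext
  rw [Submodule.coe_sum]
  exact h2

/-- multiplication by a variable -/
def symX (a : Fin v) (q : ℕ) : Symq K v q →ₗ[K] Symq K v (q+1) where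
  toFun s := symMul K v (xW K v a) s
  map_add' x y := Subtype.ext (by simp [symMul, mul_add])
  map_smul' c x := Subtype.ext (by simp [symMul])

/-- projection to symmetric powers -/
def hkprS (q : ℕ) : MvPolynomial (Fin v) K →ₗ[K] Symq K v q :=
  (homogeneousComponent q).codRestrict _ (fun p => homogeneousComponent_mem q p)

theorem hkprS_same (q : ℕ) (s : Symq K v q) : hkprS K v q (s : MvPolynomial (Fin v) K) = s :=
  Subtype.ext (homogeneousComponent_eq_self s.2)

theorem hk_deg (d : Fin v →₀ ℕ) (a : Fin v) (h : a ∈ d.support) :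
    d.degree = (d - Finsupp.single a 1).degree + 1 := by
  have : d = (d - Finsupp.single a 1) + Finsupp.single a 1 := by
    rw [tsub_add_cancel_of_le]
    rw [Finsupp.single_le_iff]
    exact Nat.one_le_iff_ne_zero.2 (Finsupp.mem_support_iff.1 h)
  conv_lhs => rw [this]
  rw [map_add]; simp

theorem hkprS_X (a : Fin v) (q : ℕ) (s : MvPolynomial (Fin v) K) :
    hkprS K v (q+1) (X a * s) = symX K v a q (hkprS K v q s) := by
  classical
  apply Subtype.ext
  change homogeneousComponent (q+1) (X a * s) = X a * homogeneousComponent q s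
  ext d
  simp only [coeff_homogeneousComponent, coeff_X_mul']
  by_cases h : a ∈ d.support
  · simp [h, hk_deg v d a h]
  · simp [h]

theorem hkprS_X0 (a : Fin v) (s : MvPolynomial (Fin v) K) :
    hkprS K v 0 (X a * s) = 0 := by
  classical
  apply Subtype.ext
  change homogeneousComponent 0 (X a * s) = 0
  ext d
  simp only [coeff_homogeneousComponent, coeff_X_mul']
  by_cases h : a ∈ d.support
  · simp [h, hk_deg v d a h]
  · simp [h]

/-- explicit Koszul map -/
def θ0 (q p : ℕ) : (↥(⋀[K]^(p+1) (Wlin K v)) ⊗[K] Symq K v q) →ₗ[K]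
        (↥(⋀[K]^p (Wlin K v)) ⊗[K] Symq K v (q+1)) :=
  ∑ a, TensorProduct.map (hkcr (eV K v a) p) (symX K v a q)

theorem hk_wedge_ext {N : Type*} [AddCommGroup N] [Module K N] (p : ℕ)
    (f g : ↥(⋀[K]^p (Wlin K v)) →ₗ[K] N)
    (h : ∀ w, f (wedgeEl K v p w) = g (wedgeEl K v p w)) : f = g := by
  refine LinearMap.ext fun ⟨x, hx⟩ => ?_
  have hx' := hx
  rw [← ExteriorAlgebra.ιMulti_span_fixedDegree] at hx'
  have : ∀ x ∈ Submodule.span K (Set.range ⇑(ExteriorAlgebra.ιMulti K p (M := Wlin K v))),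
      ∃ hx : x ∈ ⋀[K]^p (Wlin K v), f ⟨x, hx⟩ = g ⟨x, hx⟩ := by
    intro x hx
    induction hx using Submodule.span_induction with
    | mem x hx => obtain ⟨w, rfl⟩ := hx; exact ⟨_, h w⟩
    | zero => exact ⟨zero_mem _, by
        have : (⟨0, zero_mem _⟩ : ↥(⋀[K]^p (Wlin K v))) = 0 := rfl
        rw [this, map_zero, map_zero]⟩
    | add x y _ _ hx hy =>
      obtain ⟨hx, h1⟩ := hx
      obtain ⟨hy, h2⟩ := hy
      refine ⟨add_mem hx hy, ?_⟩
      have e : (⟨x + y, add_mem hx hy⟩ : ↥(⋀[K]^p (Wlin K v))) = ⟨x, hx⟩ + ⟨y, hy⟩ := rfl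
      rw [e, map_add, map_add, h1, h2]
    | smul c x _ hx =>
      obtain ⟨hx, h1⟩ := hx
      refine ⟨Submodule.smul_mem _ _ hx, ?_⟩
      have e : (⟨c • x, Submodule.smul_mem _ _ hx⟩ : ↥(⋀[K]^p (Wlin K v))) = c • ⟨x, hx⟩ := rfl
      rw [e, map_smul, map_smul, h1]
  exact (this x hx').2

theorem symMul_expand {q : ℕ} (w : Wlin K v) (s : Symq K v q) :
    symMul K v w s = ∑ a, eV K v a w • symX K v a q s := by
  apply Subtype.ext
  have := congrArg Subtype.val (hk_expand K v w)
  rw [Submodule.coe_sum] at this ⊢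
  change (w : MvPolynomial (Fin v) K) * s = _
  conv_lhs => rw [this]
  rw [Finset.sum_mul]
  refine Finset.sum_congr rfl fun a _ => ?_
  exact smul_mul_assoc _ _ _

theorem θ_eq (θ : ∀ q p : ℕ, (↥(⋀[K]^(p+1) (Wlin K v)) ⊗[K] Symq K v q) →ₗ[K]
        (↥(⋀[K]^p (Wlin K v)) ⊗[K] Symq K v (q+1)))
    (hθ : ∀ (q p : ℕ) (w : Fin (p+1) → Wlin K v) (s : Symq K v q),
      θ q p (wedgeEl K v (p+1) w ⊗ₜ s) =
        ∑ k : Fin (p+1), ((-1 : K)^(k : ℕ)) •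
          (wedgeEl K v p (fun j => w (k.succAbove j)) ⊗ₜ symMul K v (w k) s)) :
    θ = θ0 K v := by
  funext q p
  apply TensorProduct.ext
  apply hk_wedge_ext
  intro w
  refine LinearMap.ext fun s => ?_
  have e : ∀ a, hkcr (eV K v a) p (wedgeEl K v (p+1) w) =
      ∑ j : Fin (p+1), ((-1 : K)^(j : ℕ)) • eV K v a (w j) •
        wedgeEl K v p (fun i => w (j.succAbove i)) := by
    intro a
    apply Subtype.ext
    rw [Submodule.coe_sum]
    exact hkcL_ιMulti _ _ _
  refine (hθ q p w s).trans ?_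
  change _ = θ0 K v q p (wedgeEl K v (p+1) w ⊗ₜ s)
  simp only [θ0, LinearMap.sum_apply, TensorProduct.map_tmul, e, symMul_expand,
    TensorProduct.sum_tmul, TensorProduct.tmul_sum, Finset.smul_sum]
  rw [Finset.sum_comm]
  refine Finset.sum_congr rfl fun a _ => Finset.sum_congr rfl fun j _ => ?_
  rw [TensorProduct.tmul_smul, TensorProduct.smul_tmul', TensorProduct.smul_tmul']
end hkConc

section hkF
open MvPolynomial

/-- the Koszul terms -/
abbrev TT (p q : ℕ) := ↥(⋀[K]^p (Wlin K v)) ⊗[K] Symq K v q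

theorem hk_van_S {N : Type*} [AddCommGroup N] [Module K N] (r : MvPolynomial (Fin v) K →ₗ[K] N)
    (h : ∀ b s, r (X b * s) = 0) (q : ℕ) (s : Symq K v (q+1)) : r s = 0 := by
  rw [(s : MvPolynomial (Fin v) K).as_sum, map_sum]
  refine Finset.sum_eq_zero fun d hd => ?_
  have hs := (mem_homogeneousSubmodule _ _).1 s.2
  have h1 : d.degree = q + 1 := by
    by_contra hne
    exact (mem_support_iff.1 hd) (hs.coeff_eq_zero hne)
  obtain ⟨b, hb⟩ : ∃ b, b ∈ d.support := by
    by_contra hcon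
    push Not at hcon
    have : d = 0 := by
      ext b; simpa using hcon b
    rw [this] at h1
    simp at h1
  have : monomial d (coeff d (s : MvPolynomial (Fin v) K))
      = X b * monomial (d - Finsupp.single b 1) (coeff d (s : MvPolynomial (Fin v) K)) := by
    rw [X, monomial_mul, one_mul, add_tsub_cancel_of_le]
    rw [Finsupp.single_le_iff]
    exact Nat.one_le_iff_ne_zero.2 (Finsupp.mem_support_iff.1 hb)
  rw [this, h]

theorem hk_van_E {N : Type*} [AddCommGroup N] [Module K N]
    (r : ExteriorAlgebra K (Wlin K v) →ₗ[K] N)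
    (h : ∀ b s, r (ExteriorAlgebra.ι K (xW K v b) * s) = 0) (p : ℕ)
    (w : ↥(⋀[K]^(p+1) (Wlin K v))) : r w = 0 := by
  have : r ∘ₗ (Submodule.subtype (⋀[K]^(p+1) (Wlin K v))) = 0 := by
    apply hk_wedge_ext
    intro w
    change r (ExteriorAlgebra.ιMulti K (p+1) w) = 0
    rw [ExteriorAlgebra.ιMulti_succ_apply, hk_expand K v (w 0), map_sum, Finset.sum_mul, map_sum]
    refine Finset.sum_eq_zero fun b _ => ?_
    rw [map_smul, smul_mul_assoc, map_smul, h, smul_zero]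
  exact LinearMap.congr_fun this w

theorem hk_core {N : Type*} [AddCommGroup N] [Module K N] (p q : ℕ) (g : TT K v p q →ₗ[K] N)
    (h : ∀ w s, ∑ a, g (hkprE p (hkcL (eV K v a) w) ⊗ₜ hkprS K v q (X a * s)) = 0) :
    ∃ G r : MvPolynomial (Fin v) K →ₗ[K] ExteriorAlgebra K (Wlin K v) →ₗ[K] N,
      (∀ (w : ↥(⋀[K]^p (Wlin K v))) (s : Symq K v q), g (w ⊗ₜ s) =
        ∑ a, G (X a * (s : MvPolynomial (Fin v) K)) (hkcL (eV K v a) (w : ExteriorAlgebra K (Wlin K v)))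
          + r s w) ∧
      (∀ b s, r (X b * s) = 0) ∧ (∀ b s w, r s (ExteriorAlgebra.ι K (xW K v b) * w) = 0) := by
  let f : MvPolynomial (Fin v) K →ₗ[K] ExteriorAlgebra K (Wlin K v) →ₗ[K] N :=
    (((TensorProduct.mk K _ _).compr₂ g).compl₁₂ (hkprE p) (hkprS K v q)).flip
  have hf : ∀ s w, f s w = g (hkprE p w ⊗ₜ hkprS K v q s) := fun _ _ => rfl
  obtain ⟨G, r, h1, h2, h3⟩ := hk_main
    (fun a => LinearMap.lcomp K N (hkcL (eV K v a)))
    (fun a => LinearMap.lcomp K N (LinearMap.mulLeft K (ExteriorAlgebra.ι K (xW K v a))))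
    (fun a b x => by
      refine LinearMap.ext fun w => ?_
      simp only [LinearMap.lcomp_apply, LinearMap.neg_apply]
      rw [hkcL_comm, map_neg])
    (fun a x => by
      refine LinearMap.ext fun w => ?_
      simp only [LinearMap.lcomp_apply, hkcL_sq, map_zero, LinearMap.zero_apply])
    (fun a b hab x => by
      refine LinearMap.ext fun w => ?_
      simp only [LinearMap.lcomp_apply, LinearMap.neg_apply, LinearMap.mulLeft_apply, hkcL_mul,
        eV_xW, if_neg hab, zero_smul, zero_sub, map_neg, neg_neg])
    (fun a x => by
      refine LinearMap.ext fun w => ?_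
      simp only [LinearMap.lcomp_apply, LinearMap.add_apply, LinearMap.mulLeft_apply, hkcL_mul,
        eV_xW, if_true, one_smul, map_sub]
      abel)
    (fun a b x => by
      refine LinearMap.ext fun w => ?_
      simp only [LinearMap.lcomp_apply, LinearMap.neg_apply, LinearMap.mulLeft_apply, ← mul_assoc]
      rw [hk_ι_anti, neg_mul, map_neg])
    (fun a x => by
      refine LinearMap.ext fun w => ?_
      simp only [LinearMap.lcomp_apply, LinearMap.mulLeft_apply, ← mul_assoc,
        ExteriorAlgebra.ι_sq_zero, zero_mul, map_zero, LinearMap.zero_apply])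
    f (fun s => by
      refine LinearMap.ext fun w => ?_
      rw [LinearMap.sum_apply]
      exact h w s)
  refine ⟨G, r, ?_, h2, ?_⟩
  · intro w s
    have := LinearMap.congr_fun (h1 s) w
    rw [hf, hkprE_same, hkprS_same, LinearMap.add_apply, LinearMap.sum_apply] at this
    exact this
  · intro b s w
    exact LinearMap.congr_fun (h3 b s) w

theorem θ0_tmul (q p : ℕ) (w : ↥(⋀[K]^(p+1) (Wlin K v))) (s : Symq K v q) :
    θ0 K v q p (w ⊗ₜ s) = ∑ a, hkcr (eV K v a) p w ⊗ₜ symX K v a q s := by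
  simp only [θ0, LinearMap.sum_apply, TensorProduct.map_tmul]

/-- restriction of a total bilinear map -/
def hkres {N : Type*} [AddCommGroup N] [Module K N] (p q : ℕ)
    (G : MvPolynomial (Fin v) K →ₗ[K] ExteriorAlgebra K (Wlin K v) →ₗ[K] N) :
    TT K v p q →ₗ[K] N :=
  TensorProduct.lift (G.flip.compl₁₂ (Submodule.subtype _) (Submodule.subtype _))

theorem hkres_tmul {N : Type*} [AddCommGroup N] [Module K N] (p q : ℕ)
    (G : MvPolynomial (Fin v) K →ₗ[K] ExteriorAlgebra K (Wlin K v) →ₗ[K] N)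
    (w : ↥(⋀[K]^p (Wlin K v))) (s : Symq K v q) : hkres K v p q G (w ⊗ₜ s) = G s w := rfl

theorem hkF2 {N : Type*} [AddCommGroup N] [Module K N] (p q : ℕ)
    (g : TT K v (p+1) (q+1) →ₗ[K] N) (h : g ∘ₗ θ0 K v q (p+1) = 0) :
    ∃ g' : TT K v p (q+2) →ₗ[K] N, g = g' ∘ₗ θ0 K v (q+1) p := by
  obtain ⟨G, r, h1, h2, h3⟩ := hk_core K v (p+1) (q+1) g (fun w s => by
    simp only [hkprE_cL, hkprS_X]
    rw [← map_sum, ← θ0_tmul]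
    exact LinearMap.congr_fun h _)
  refine ⟨hkres K v p (q+2) G, TensorProduct.ext' fun w s => ?_⟩
  rw [h1, hk_van_S K v r h2, LinearMap.zero_apply, add_zero, LinearMap.comp_apply, θ0_tmul, map_sum]
  rfl

theorem hkF2z {N : Type*} [AddCommGroup N] [Module K N] (p : ℕ)
    (g : TT K v (p+1) 0 →ₗ[K] N) :
    ∃ g' : TT K v p 1 →ₗ[K] N, g = g' ∘ₗ θ0 K v 0 p := by
  obtain ⟨G, r, h1, h2, h3⟩ := hk_core K v (p+1) 0 g (fun w s => by
    simp only [hkprS_X0, TensorProduct.tmul_zero, map_zero, Finset.sum_const_zero])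
  refine ⟨hkres K v p 1 G, TensorProduct.ext' fun w s => ?_⟩
  rw [h1, hk_van_E K v (r s) (fun b w => h3 b s w), add_zero, LinearMap.comp_apply, θ0_tmul, map_sum]
  rfl

theorem hk_zero_mem {w : ExteriorAlgebra K (Wlin K v)} (hw : w ∈ ⋀[K]^0 (Wlin K v)) :
    ∃ r : K, algebraMap K _ r = w := by
  have : w ∈ (LinearMap.range (ExteriorAlgebra.ι K (M := Wlin K v))) ^ 0 := hw
  rw [pow_zero] at this
  exact Submodule.mem_one.1 this

theorem hkF20 {N : Type*} [AddCommGroup N] [Module K N] (q : ℕ)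
    (g : TT K v 0 (q+1) →ₗ[K] N) (h : g ∘ₗ θ0 K v q 0 = 0) : g = 0 := by
  obtain ⟨G, r, h1, h2, h3⟩ := hk_core K v 0 (q+1) g (fun w s => by
    simp only [hkprE_cL, hkprS_X]
    rw [← map_sum, ← θ0_tmul]
    exact LinearMap.congr_fun h _)
  refine TensorProduct.ext' fun w s => ?_
  rw [h1, hk_van_S K v r h2, LinearMap.zero_apply, add_zero]
  obtain ⟨c, hc⟩ := hk_zero_mem K v w.2
  simp only [← hc, hkcL_alg, map_zero, Finset.sum_const_zero, LinearMap.zero_apply]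

/-- multiplication by a variable on Koszul terms -/
def xT (a : Fin v) (p q : ℕ) : TT K v p q →ₗ[K] TT K v p (q+1) :=
  TensorProduct.map LinearMap.id (symX K v a q)

theorem symX_comm (a b : Fin v) (q : ℕ) (s : Symq K v q) :
    symX K v a (q+1) (symX K v b q s) = symX K v b (q+1) (symX K v a q s) :=
  Subtype.ext (by
    change X a * (X b * (s : MvPolynomial (Fin v) K)) = X b * (X a * (s : MvPolynomial (Fin v) K))
    ring)

theorem xT_θ0 (a : Fin v) (p q : ℕ) (t : TT K v (p+1) q) :
    θ0 K v (q+1) p (xT K v a (p+1) q t) = xT K v a p (q+1) (θ0 K v q p t) := by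
  induction t using TensorProduct.induction_on with
  | zero => simp
  | add x y hx hy => simp only [map_add, hx, hy]
  | tmul w s =>
    simp only [xT, θ0_tmul, TensorProduct.map_tmul, map_sum, LinearMap.id_apply]
    refine Finset.sum_congr rfl fun b _ => ?_
    rw [symX_comm]

theorem hk_antisum {N : Type*} [AddCommGroup N] {n : ℕ} (G : Fin n → Fin n → N)
    (h1 : ∀ a b, G a b = -(G b a)) (h2 : ∀ a, G a a = 0) : ∑ a, ∑ b, G a b = 0 := by
  rw [← Fintype.sum_prod_type']
  refine Finset.sum_involution (fun x _ => x.swap) ?_ ?_ ?_ ?_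
  · rintro ⟨a, b⟩ _
    simp only [Prod.swap]
    rw [h1 a b]; simp
  · rintro ⟨a, b⟩ _ hne heq
    simp only [Prod.swap, Prod.mk.injEq] at heq
    rw [heq.1, h2] at hne
    exact hne rfl
  · simp
  · simp

theorem θθ (p q : ℕ) (t : TT K v (p+2) q) : θ0 K v (q+1) p (θ0 K v q (p+1) t) = 0 := by
  induction t using TensorProduct.induction_on with
  | zero => simp
  | add x y hx hy => simp only [map_add, hx, hy, add_zero]
  | tmul w s =>
    simp only [θ0_tmul, map_sum]
    refine hk_antisum _ (fun a b => ?_) (fun a => ?_)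
    · have : hkcr (eV K v b) p (hkcr (eV K v a) (p+1) w)
          = -(hkcr (eV K v a) p (hkcr (eV K v b) (p+1) w)) := Subtype.ext (hkcL_comm _ _ _)
      rw [this, symX_comm, TensorProduct.neg_tmul]
    · have : hkcr (eV K v a) p (hkcr (eV K v a) (p+1) w) = 0 := Subtype.ext (hkcL_sq _ _)
      rw [this, TensorProduct.zero_tmul]

/-- Cartan differential -/
def dB (p q : ℕ) : (TT K v p (q+1) →ₗ[K] ExtE K v) →ₗ[ExtE K v] (TT K v p q →ₗ[K] ExtE K v) where
  toFun g := ∑ a, LinearMap.mulRight K (ExteriorAlgebra.ι K (eV K v a)) ∘ₗ g ∘ₗ xT K v a p q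
  map_add' x y := by
    refine LinearMap.ext fun t => ?_
    simp only [LinearMap.sum_apply, LinearMap.add_apply, LinearMap.comp_apply, map_add,
      Finset.sum_add_distrib]
  map_smul' c x := by
    refine LinearMap.ext fun t => ?_
    simp only [LinearMap.sum_apply, LinearMap.smul_apply, LinearMap.comp_apply, RingHom.id_apply,
      LinearMap.mulRight_apply, smul_eq_mul, Finset.mul_sum, mul_assoc]

theorem dB_apply (p q : ℕ) (g : TT K v p (q+1) →ₗ[K] ExtE K v) (t : TT K v p q) :
    dB K v p q g t = ∑ a, g (xT K v a p q t) * ExteriorAlgebra.ι K (eV K v a) := by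
  simp only [dB, LinearMap.coe_mk, AddHom.coe_mk, LinearMap.sum_apply, LinearMap.comp_apply,
    LinearMap.mulRight_apply]

theorem dB_θ (p q : ℕ) (g : TT K v p (q+2) →ₗ[K] ExtE K v) :
    dB K v (p+1) q (g ∘ₗ θ0 K v (q+1) p) = dB K v p (q+1) g ∘ₗ θ0 K v q p := by
  refine LinearMap.ext fun t => ?_
  simp only [dB_apply, LinearMap.comp_apply, xT_θ0]

theorem xT_comm (a b : Fin v) (p q : ℕ) (t : TT K v p q) :
    xT K v a p (q+1) (xT K v b p q t) = xT K v b p (q+1) (xT K v a p q t) := by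
  induction t using TensorProduct.induction_on with
  | zero => simp
  | add x y hx hy => simp only [map_add, hx, hy]
  | tmul w s =>
    simp only [xT, TensorProduct.map_tmul, LinearMap.id_apply]
    rw [symX_comm]

theorem dBdB (p q : ℕ) (g : TT K v p (q+2) →ₗ[K] ExtE K v) :
    dB K v p q (dB K v p (q+1) g) = 0 := by
  refine LinearMap.ext fun t => ?_
  simp only [dB_apply, Finset.sum_mul]
  refine hk_antisum _ (fun a b => ?_) (fun a => ?_)
  · rw [xT_comm, mul_assoc, mul_assoc, hk_ι_anti, mul_neg]
  · rw [mul_assoc, ExteriorAlgebra.ι_sq_zero, mul_zero]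

theorem hkF1 (p q : ℕ) (g : TT K v p (q+1) →ₗ[K] ExtE K v) (h : dB K v p q g = 0) :
    ∃ b : TT K v p (q+2) →ₗ[K] ExtE K v, g = dB K v p (q+1) b := by
  let f : MvPolynomial (Fin v) K →ₗ[K] ↥(⋀[K]^p (Wlin K v)) →ₗ[K] ExtE K v :=
    (((TensorProduct.mk K _ _).compr₂ g).compl₂ (hkprS K v (q+1))).flip
  have hf : ∀ s w, f s w = g (w ⊗ₜ hkprS K v (q+1) s) := fun _ _ => rfl
  obtain ⟨G, r, h1, h2, -⟩ := hk_main
    (fun a => LinearMap.llcomp K (↥(⋀[K]^p (Wlin K v))) _ _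
      (LinearMap.mulRight K (ExteriorAlgebra.ι K (eV K v a))))
    (fun a => LinearMap.llcomp K (↥(⋀[K]^p (Wlin K v))) _ _
      (hkcR (Module.Dual.eval K _ (xW K v a))))
    (fun a b x => by
      refine LinearMap.ext fun w => ?_
      simp only [LinearMap.llcomp_apply, LinearMap.neg_apply, LinearMap.mulRight_apply]
      rw [mul_assoc, mul_assoc, hk_ι_anti, mul_neg])
    (fun a x => by
      refine LinearMap.ext fun w => ?_
      simp only [LinearMap.llcomp_apply, LinearMap.mulRight_apply, mul_assoc,
        ExteriorAlgebra.ι_sq_zero, mul_zero, LinearMap.zero_apply])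
    (fun a b hab x => by
      refine LinearMap.ext fun w => ?_
      simp only [LinearMap.llcomp_apply, LinearMap.neg_apply, LinearMap.mulRight_apply, hkcR_mul,
        Module.Dual.eval_apply, eV_xW, if_neg hab, zero_smul, zero_sub, neg_neg])
    (fun a x => by
      refine LinearMap.ext fun w => ?_
      simp only [LinearMap.llcomp_apply, LinearMap.add_apply, LinearMap.mulRight_apply, hkcR_mul,
        Module.Dual.eval_apply, eV_xW, if_true, one_smul]
      abel)
    (fun a b x => by
      refine LinearMap.ext fun w => ?_
      simp only [LinearMap.llcomp_apply, LinearMap.neg_apply]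
      rw [hkcR_comm])
    (fun a x => by
      refine LinearMap.ext fun w => ?_
      simp only [LinearMap.llcomp_apply, hkcR_sq, LinearMap.zero_apply])
    f (fun s => by
      refine LinearMap.ext fun w => ?_
      rw [LinearMap.sum_apply]
      simp only [LinearMap.llcomp_apply, LinearMap.mulRight_apply, hf, hkprS_X]
      have := LinearMap.congr_fun h (w ⊗ₜ hkprS K v q s)
      rw [dB_apply] at this
      exact this)
  refine ⟨TensorProduct.lift (G.flip.compl₂ (Submodule.subtype _)),
    TensorProduct.ext' fun w s => ?_⟩
  have := LinearMap.congr_fun (h1 s) w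
  rw [hf, hkprS_same, hk_van_S K v r h2, add_zero, LinearMap.sum_apply] at this
  rw [this, dB_apply]
  rfl
end hkF

section hkG
open MvPolynomial

theorem hk_desc {R A B C : Type*} [Ring R] [AddCommGroup A] [AddCommGroup B] [AddCommGroup C]
    [Module R A] [Module R B] [Module R C] (f : A →ₗ[R] B) (hf : Function.Surjective f)
    (σ : A →ₗ[R] C) (h : ∀ a, f a = 0 → σ a = 0) : ∃ τ : B →ₗ[R] C, ∀ a, τ (f a) = σ a := by
  have hk : LinearMap.ker f ≤ LinearMap.ker σ := fun a ha => h a ha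
  refine ⟨(LinearMap.ker f).liftQ σ hk ∘ₗ (f.quotKerEquivOfSurjective hf).symm.toLinearMap,
    fun a => ?_⟩
  have : (f.quotKerEquivOfSurjective hf).symm (f a) = Submodule.Quotient.mk a := by
    rw [LinearEquiv.symm_apply_eq]; rfl
  simp only [LinearMap.comp_apply, LinearEquiv.coe_coe, this]
  rfl

/-- precomposition with the Koszul map -/
def hkR (p q : ℕ) : (TT K v p (q+1) →ₗ[K] ExtE K v) →ₗ[ExtE K v]
    (TT K v (p+1) q →ₗ[K] ExtE K v) where
  toFun g := g ∘ₗ θ0 K v q p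
  map_add' _ _ := rfl
  map_smul' _ _ := rfl

theorem hk_comp_θθ (p q : ℕ) (g : TT K v p (q+2) →ₗ[K] ExtE K v) :
    (g ∘ₗ θ0 K v (q+1) p) ∘ₗ θ0 K v q (p+1) = 0 := by
  refine LinearMap.ext fun t => ?_
  simp only [LinearMap.comp_apply, θθ, map_zero, LinearMap.zero_apply]

theorem hk_lift (p q : ℕ) (g : TT K v (p+1) (q+1) →ₗ[K] ExtE K v)
    (b' : TT K v p (q+2) →ₗ[K] ExtE K v)
    (h : dB K v (p+1) q g = dB K v p (q+1) b' ∘ₗ θ0 K v q p) :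
    ∃ b : TT K v (p+1) (q+2) →ₗ[K] ExtE K v,
      g ∘ₗ θ0 K v q (p+1) = dB K v (p+1) (q+1) b ∘ₗ θ0 K v q (p+1) := by
  rw [← dB_θ, ← sub_eq_zero, ← map_sub] at h
  obtain ⟨b, hb⟩ := hkF1 K v _ _ _ h
  refine ⟨b, ?_⟩
  rw [← hb, LinearMap.sub_comp, hk_comp_θθ, sub_zero]

theorem hk_Q (p : ℕ) : ∀ (l : ℕ) (g : TT K v p (l+2) →ₗ[K] ExtE K v),
    dB K v p (l+1) g ∘ₗ θ0 K v l p = 0 →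
    ∃ b : TT K v p (l+3) →ₗ[K] ExtE K v,
      g ∘ₗ θ0 K v (l+1) p = dB K v p (l+2) b ∘ₗ θ0 K v (l+1) p := by
  induction p with
  | zero =>
    intro l g h
    have h1 := hkF20 K v _ _ h
    obtain ⟨b, hb⟩ := hkF1 K v _ _ _ h1
    exact ⟨b, by rw [← hb]⟩
  | succ p ih =>
    intro l g h
    obtain ⟨g', hg'⟩ := hkF2 K v _ _ _ h
    have h1 : dB K v p (l+1) g' ∘ₗ θ0 K v l p = 0 := by
      rw [← dB_θ, ← hg', dBdB]
    obtain ⟨b', hb'⟩ := ih l g' h1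
    rw [hb'] at hg'
    exact hk_lift K v _ _ _ _ hg'

/-- scalar functionals as `E`-valued maps -/
def hk1 {H : Type*} [AddCommGroup H] [Module K H] (φ : H →ₗ[K] K) : H →ₗ[K] ExtE K v :=
  Algebra.linearMap K (ExtE K v) ∘ₗ φ

theorem hk1_apply {H : Type*} [AddCommGroup H] [Module K H] (φ : H →ₗ[K] K) (h : H) :
    hk1 K v φ h = algebraMap K (ExtE K v) (φ h) := rfl

/-- the properties of the augmentation -/
structure hkGood (p : ℕ) (τ : (TT K v p 0 →ₗ[K] ExtE K v) →ₗ[ExtE K v] ExtE K v) : Prop where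
  Z : ∀ g : TT K v p 1 →ₗ[K] ExtE K v, g ∘ₗ θ0 K v 0 p = 0 → τ (dB K v p 0 g) = 0
  W : ∀ g : TT K v p 1 →ₗ[K] ExtE K v, τ (dB K v p 0 g) = 0 →
    ∃ b : TT K v p 2 →ₗ[K] ExtE K v, g ∘ₗ θ0 K v 0 p = dB K v p 1 b ∘ₗ θ0 K v 0 p
  I1 : ∀ φ : TT K v p 0 →ₗ[K] K, τ (hk1 K v φ) ∈ ⋀[K]^p (Vdu K v)
  I2 : ∀ y ∈ ⋀[K]^p (Vdu K v), ∃ φ : TT K v p 0 →ₗ[K] K, τ (hk1 K v φ) = y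

theorem hk_dB_one (p : ℕ) (ψ : TT K v p 1 →ₗ[K] K) :
    dB K v p 0 (hk1 K v ψ) = ∑ a, ExteriorAlgebra.ι K (eV K v a) •
      hk1 K v (ψ ∘ₗ xT K v a p 0) := by
  refine LinearMap.ext fun t => ?_
  rw [dB_apply, LinearMap.sum_apply]
  refine Finset.sum_congr rfl fun a _ => ?_
  rw [LinearMap.smul_apply, hk1_apply, hk1_apply, smul_eq_mul, LinearMap.comp_apply]
  exact Algebra.commutes _ _

/-- unit of `Sym_0` -/
def hkS1 : Symq K v 0 := ⟨1, (mem_homogeneousSubmodule _ _).2 (isHomogeneous_one _ _)⟩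

theorem hkS0 (s : Symq K v 0) : s = coeff 0 (s : MvPolynomial (Fin v) K) • hkS1 K v := by
  have hs := (mem_homogeneousSubmodule _ _).1 s.2
  refine Subtype.ext ?_
  change (s : MvPolynomial (Fin v) K) = coeff 0 (s : MvPolynomial (Fin v) K) • 1
  rw [smul_eq_C_mul, mul_one]
  exact totalDegree_eq_zero_iff_eq_C.1 (Nat.le_zero.1 hs.totalDegree_le)

theorem hk_m (m : Vdu K v) : m = ∑ a, m (xW K v a) • eV K v a := by
  refine LinearMap.ext fun w => ?_
  conv_lhs => rw [hk_expand K v w]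
  simp [mul_comm]

theorem hk_I2 (p : ℕ) (φ : TT K v p 0 →ₗ[K] K) (m : Vdu K v) : ∃ ψ : TT K v p 1 →ₗ[K] K,
    dB K v p 0 (hk1 K v ψ) = ExteriorAlgebra.ι K m • hk1 K v φ := by
  let ψ : TT K v p 1 →ₗ[K] K := LinearMap.mul' K K ∘ₗ TensorProduct.map
    (φ ∘ₗ (TensorProduct.mk K _ _).flip (hkS1 K v)) m
  refine ⟨ψ, ?_⟩
  have h : ∀ a, ψ ∘ₗ xT K v a p 0 = m (xW K v a) • φ := by
    intro a
    refine TensorProduct.ext' fun w s => ?_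
    rw [hkS0 K v s]
    have : symX K v a 0 (hkS1 K v) = xW K v a := Subtype.ext (mul_one _)
    simp only [ψ, xT, LinearMap.comp_apply, TensorProduct.map_tmul, LinearMap.mul'_apply,
      LinearMap.id_apply, map_smul, this, LinearMap.smul_apply, TensorProduct.tmul_smul,
      LinearMap.flip_apply, TensorProduct.mk_apply, smul_eq_mul]
    ring
  rw [hk_dB_one]
  conv_rhs => rw [hk_m K v m, map_sum, Finset.sum_smul]
  refine Finset.sum_congr rfl fun a _ => ?_
  rw [h]
  refine LinearMap.ext fun t => ?_
  simp only [LinearMap.smul_apply, hk1_apply, smul_eq_mul, map_smul, map_mul]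
  rw [Algebra.algebraMap_eq_smul_one, smul_mul_assoc, one_mul, mul_smul_comm, smul_mul_assoc]

theorem hk_good_succ (p : ℕ) (τ : (TT K v p 0 →ₗ[K] ExtE K v) →ₗ[ExtE K v] ExtE K v)
    (hτ : hkGood K v p τ) : ∃ τ' : (TT K v (p+1) 0 →ₗ[K] ExtE K v) →ₗ[ExtE K v] ExtE K v,
    hkGood K v (p+1) τ' ∧ ∀ g : TT K v p 1 →ₗ[K] ExtE K v,
      τ' (g ∘ₗ θ0 K v 0 p) = τ (dB K v p 0 g) := by
  obtain ⟨τ', h⟩ := hk_desc (hkR K v p 0)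
    (fun g => (hkF2z K v p g).imp fun _ h => h.symm) (τ ∘ₗ dB K v p 0) hτ.Z
  replace h : ∀ g : TT K v p 1 →ₗ[K] ExtE K v,
      τ' (g ∘ₗ θ0 K v 0 p) = τ (dB K v p 0 g) := h
  refine ⟨τ', ⟨?_, ?_, ?_, ?_⟩, h⟩
  · intro g hg
    obtain ⟨g', rfl⟩ := hkF2 K v _ _ _ hg
    rw [dB_θ, h, dBdB, map_zero]
  · intro g hg
    obtain ⟨g', hg'⟩ := hkF2z K v p (dB K v (p+1) 0 g)
    rw [hg', h] at hg
    obtain ⟨b', hb'⟩ := hτ.W g' hg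
    rw [hb'] at hg'
    exact hk_lift K v _ _ _ _ hg'
  · intro φ
    obtain ⟨ψ, rfl⟩ := hkF2z K v p φ
    have : hk1 K v (ψ ∘ₗ θ0 K v 0 p) = hk1 K v ψ ∘ₗ θ0 K v 0 p := rfl
    rw [this, h, hk_dB_one, map_sum]
    refine Submodule.sum_mem _ fun a _ => ?_
    rw [map_smul, smul_eq_mul]
    change _ ∈ (LinearMap.range (ExteriorAlgebra.ι K (M := Vdu K v))) ^ (p+1)
    rw [pow_succ']
    exact Submodule.mul_mem_mul ⟨_, rfl⟩ (hτ.I1 _)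
  · intro y hy
    replace hy : y ∈ (LinearMap.range (ExteriorAlgebra.ι K (M := Vdu K v))) ^ (p+1) := hy
    rw [pow_succ'] at hy
    refine Submodule.mul_induction_on hy ?_ ?_
    · intro m hm n hn
      obtain ⟨m, rfl⟩ := hm
      obtain ⟨φ, rfl⟩ := hτ.I2 n hn
      obtain ⟨ψ, hψ⟩ := hk_I2 K v p φ m
      refine ⟨ψ ∘ₗ θ0 K v 0 p, ?_⟩
      have : hk1 K v (ψ ∘ₗ θ0 K v 0 p) = hk1 K v ψ ∘ₗ θ0 K v 0 p := rfl
      rw [this, h, hψ, map_smul, smul_eq_mul]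
    · intro x y hx hy
      obtain ⟨φ, rfl⟩ := hx
      obtain ⟨ψ, rfl⟩ := hy
      refine ⟨φ + ψ, ?_⟩
      rw [← map_add]
      congr 1
      refine LinearMap.ext fun t => ?_
      simp only [hk1_apply, LinearMap.add_apply, map_add]

/-- unit of `⋀^0` -/
def hkE1 : ↥(⋀[K]^0 (Wlin K v)) :=
  ⟨1, by
    change (1 : ExteriorAlgebra K (Wlin K v)) ∈
      (LinearMap.range (ExteriorAlgebra.ι K (M := Wlin K v))) ^ 0
    rw [pow_zero]; exact Submodule.one_le.1 le_rfl⟩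

theorem hkE0 (w : ↥(⋀[K]^0 (Wlin K v))) :
    w = ExteriorAlgebra.algebraMapInv (w : ExteriorAlgebra K (Wlin K v)) • hkE1 K v := by
  obtain ⟨c, hc⟩ := hk_zero_mem K v w.2
  refine Subtype.ext ?_
  change (w : ExteriorAlgebra K (Wlin K v)) = _ • (1 : ExteriorAlgebra K (Wlin K v))
  rw [← hc, ExteriorAlgebra.algebraMap_leftInverse, Algebra.algebraMap_eq_smul_one]

/-- evaluation at the unit -/
def hkτ0 : (TT K v 0 0 →ₗ[K] ExtE K v) →ₗ[ExtE K v] ExtE K v where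
  toFun g := g (hkE1 K v ⊗ₜ hkS1 K v)
  map_add' _ _ := rfl
  map_smul' _ _ := rfl

theorem hk_T00 {N : Type*} [AddCommGroup N] [Module K N] (g : TT K v 0 0 →ₗ[K] N)
    (h : g (hkE1 K v ⊗ₜ hkS1 K v) = 0) : g = 0 := by
  refine TensorProduct.ext' fun w s => ?_
  rw [hkE0 K v w, hkS0 K v s, TensorProduct.smul_tmul_smul, map_smul, h, smul_zero]
  rfl

theorem hk_good_zero : hkGood K v 0 (hkτ0 K v) := by
  refine ⟨?_, ?_, ?_, ?_⟩
  · intro g hg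
    rw [hkF20 K v _ _ hg, map_zero, map_zero]
  · intro g hg
    obtain ⟨b, hb⟩ := hkF1 K v _ _ _ (hk_T00 K v _ hg)
    exact ⟨b, by rw [← hb]⟩
  · intro φ
    change algebraMap K (ExtE K v) _ ∈
      (LinearMap.range (ExteriorAlgebra.ι K (M := Vdu K v))) ^ 0
    rw [pow_zero]
    exact Submodule.mem_one.2 ⟨_, rfl⟩
  · intro y hy
    replace hy : y ∈ (LinearMap.range (ExteriorAlgebra.ι K (M := Vdu K v))) ^ 0 := hy
    rw [pow_zero] at hy
    obtain ⟨c, rfl⟩ := Submodule.mem_one.1 hy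
    refine ⟨c • (LinearMap.mul' K K ∘ₗ TensorProduct.map
      (ExteriorAlgebra.algebraMapInv.toLinearMap ∘ₗ Submodule.subtype _)
      (lcoeff K 0 ∘ₗ Submodule.subtype _)), ?_⟩
    change algebraMap K (ExtE K v) _ = _
    congr 1
    simp only [LinearMap.smul_apply, LinearMap.comp_apply, TensorProduct.map_tmul,
      LinearMap.mul'_apply, hkE1, hkS1, Submodule.subtype_apply, AlgHom.toLinearMap_apply, map_one,
      lcoeff_apply, smul_eq_mul, coeff_zero_one, mul_one]

theorem hk_good (p : ℕ) : ∃ τ, hkGood K v p τ := by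
  induction p with
  | zero => exact ⟨_, hk_good_zero K v⟩
  | succ p ih =>
    obtain ⟨τ, h⟩ := ih
    obtain ⟨τ', h', -⟩ := hk_good_succ K v p τ h
    exact ⟨τ', h'⟩

end hkG

section hkH
open MvPolynomial

/-- free modules as Hom spaces, forward map -/
def hkΦf (H : Type) [AddCommGroup H] [Module K H] :
    (ExtE K v ⊗[K] Module.Dual K H) →ₗ[ExtE K v] (H →ₗ[K] ExtE K v) :=
  TensorProduct.AlgebraTensorModule.lift
    (LinearMap.toSpanSingleton (ExtE K v) (Module.Dual K H →ₗ[K] (H →ₗ[K] ExtE K v))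
      (LinearMap.llcomp K H K (ExtE K v) (Algebra.linearMap K (ExtE K v))))

theorem hkΦf_tmul (H : Type) [AddCommGroup H] [Module K H] (e : ExtE K v) (φ : Module.Dual K H) :
    hkΦf K v H (e ⊗ₜ φ) = e • hk1 K v φ := rfl

theorem hk_sum {H : Type} [AddCommGroup H] [Module K H] {n : ℕ} (b : Module.Basis (Fin n) K H)
    (F : H →ₗ[K] ExtE K v) : ∑ j, F (b j) • hk1 K v (b.coord j) = F := by
  refine b.ext fun k => ?_
  rw [LinearMap.sum_apply, Finset.sum_eq_single k]
  · simp [hk1_apply]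
  · intro j _ hj
    simp [hk1_apply, Finsupp.single_eq_of_ne hj, Finsupp.single_eq_of_ne hj.symm]
  · simp

theorem hk_alg_smul (c : K) (e : ExtE K v) : e • algebraMap K (ExtE K v) c = c • e := by
  rw [smul_eq_mul, Algebra.algebraMap_eq_smul_one, mul_smul_comm, mul_one]

theorem hkΦ_bij (H : Type) [AddCommGroup H] [Module K H] [Module.Finite K H] :
    Function.Bijective (hkΦf K v H) := by
  let b := Module.finBasis K H
  let inv : (H →ₗ[K] ExtE K v) →+ (ExtE K v ⊗[K] Module.Dual K H) :=
    { toFun := fun F => ∑ j, F (b j) ⊗ₜ b.coord j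
      map_zero' := by simp
      map_add' := fun x y => by
        simp only [LinearMap.add_apply, TensorProduct.add_tmul, Finset.sum_add_distrib] }
  have hinv : ∀ F, inv F = ∑ j, F (b j) ⊗ₜ b.coord j := fun _ => rfl
  refine Function.bijective_iff_has_inverse.2 ⟨inv, fun x => ?_, fun F => ?_⟩
  · induction x using TensorProduct.induction_on with
    | zero => rw [map_zero, map_zero]
    | add x y hx hy => rw [map_add, map_add, hx, hy]
    | tmul e φ =>
      rw [hkΦf_tmul, hinv]
      have h : φ = ∑ j, φ (b j) • b.coord j := by
        refine b.ext fun k => ?_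
        rw [LinearMap.sum_apply, Finset.sum_eq_single k]
        · simp
        · intro j _ hj
          simp [Finsupp.single_eq_of_ne hj, Finsupp.single_eq_of_ne hj.symm]
        · simp
      conv_rhs => rw [h, TensorProduct.tmul_sum]
      refine Finset.sum_congr rfl fun j _ => ?_
      rw [LinearMap.smul_apply, hk1_apply, hk_alg_smul, TensorProduct.smul_tmul]
  · rw [hinv, map_sum]
    simp only [hkΦf_tmul]
    exact hk_sum K v b F

/-- free modules as Hom spaces -/
def hkΦ (H : Type) [AddCommGroup H] [Module K H] [Module.Finite K H] :
    (ExtE K v ⊗[K] Module.Dual K H) ≃ₗ[ExtE K v] (H →ₗ[K] ExtE K v) :=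
  LinearEquiv.ofBijective (hkΦf K v H) (hkΦ_bij K v H)

/-- the hook module -/
abbrev hkH (i l : ℕ) := ↥(LinearMap.range (θ0 K v l i))

/-- multiplication by a variable on the hook modules -/
def hkx (a : Fin v) (i l : ℕ) : hkH K v i l →ₗ[K] hkH K v i (l+1) :=
  (xT K v a i (l+1)).restrict (by
    rintro _ ⟨t, rfl⟩
    exact ⟨_, xT_θ0 K v a i l t⟩)

/-- the differential -/
def dC (i l : ℕ) : (hkH K v i (l+1) →ₗ[K] ExtE K v) →ₗ[ExtE K v] (hkH K v i l →ₗ[K] ExtE K v) where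
  toFun g := ∑ a, LinearMap.mulRight K (ExteriorAlgebra.ι K (eV K v a)) ∘ₗ g ∘ₗ hkx K v a i l
  map_add' x y := by
    refine LinearMap.ext fun t => ?_
    simp only [LinearMap.sum_apply, LinearMap.add_apply, LinearMap.comp_apply, map_add,
      Finset.sum_add_distrib]
  map_smul' c x := by
    refine LinearMap.ext fun t => ?_
    simp only [LinearMap.sum_apply, LinearMap.smul_apply, LinearMap.comp_apply, RingHom.id_apply,
      LinearMap.mulRight_apply, smul_eq_mul, Finset.mul_sum, mul_assoc]

theorem dC_apply (i l : ℕ) (g : hkH K v i (l+1) →ₗ[K] ExtE K v) (t : hkH K v i l) :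
    dC K v i l g t = ∑ a, g (hkx K v a i l t) * ExteriorAlgebra.ι K (eV K v a) := by
  simp only [dC, LinearMap.coe_mk, AddHom.coe_mk, LinearMap.sum_apply, LinearMap.comp_apply,
    LinearMap.mulRight_apply]

theorem dC_sub (i l : ℕ) (g : TT K v i (l+2) →ₗ[K] ExtE K v) :
    dC K v i l (g ∘ₗ Submodule.subtype _) = dB K v i (l+1) g ∘ₗ Submodule.subtype _ := by
  refine LinearMap.ext fun t => ?_
  rw [dC_apply, LinearMap.comp_apply, dB_apply]
  rfl

theorem hk_sub_iff (i l : ℕ) (f g : TT K v i (l+1) →ₗ[K] ExtE K v) :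
    f ∘ₗ Submodule.subtype (LinearMap.range (θ0 K v l i)) = g ∘ₗ Submodule.subtype _ ↔
      f ∘ₗ θ0 K v l i = g ∘ₗ θ0 K v l i := by
  constructor
  · intro h
    exact LinearMap.ext fun t => LinearMap.congr_fun h ⟨_, ⟨t, rfl⟩⟩
  · intro h
    refine LinearMap.ext ?_
    rintro ⟨_, ⟨t, rfl⟩⟩
    exact LinearMap.congr_fun h t

set_option maxHeartbeats 4000000 in
theorem dC_exact (i l : ℕ) : LinearMap.ker (dC K v i l) = LinearMap.range (dC K v i (l+1)) := by
  ext f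
  rw [LinearMap.mem_ker, LinearMap.mem_range]
  constructor
  · intro h
    obtain ⟨g, rfl⟩ := LinearMap.exists_extend f
    rw [dC_sub] at h
    have h1 : dB K v i (l+1) g ∘ₗ θ0 K v l i = 0 := by
      have := (hk_sub_iff K v i l (dB K v i (l+1) g) 0).1 (by rw [h, LinearMap.zero_comp])
      rw [this, LinearMap.zero_comp]
    obtain ⟨b, hb⟩ := hk_Q K v i l g h1
    refine ⟨b ∘ₗ Submodule.subtype _, ?_⟩
    rw [dC_sub]
    exact ((hk_sub_iff K v i (l+1) _ _).2 hb).symm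
  · rintro ⟨f', rfl⟩
    obtain ⟨g, rfl⟩ := LinearMap.exists_extend f'
    rw [dC_sub, dC_sub, dBdB, LinearMap.zero_comp]

set_option maxHeartbeats 4000000 in
theorem hk_aug (i : ℕ) : ∃ ε : (hkH K v i 0 →ₗ[K] ExtE K v) →ₗ[ExtE K v] ExtE K v,
    LinearMap.range ε = mPow K v (i+1) ∧ LinearMap.ker ε = LinearMap.range (dC K v i 0) := by
  obtain ⟨τ, hτ⟩ := hk_good K v i
  obtain ⟨τ', hτ', h⟩ := hk_good_succ K v i τ hτ
  let ρ : (hkH K v i 0 →ₗ[K] ExtE K v) →ₗ[ExtE K v] (TT K v (i+1) 0 →ₗ[K] ExtE K v) :=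
    { toFun := fun f => f ∘ₗ (θ0 K v 0 i).rangeRestrict
      map_add' := fun _ _ => rfl
      map_smul' := fun _ _ => rfl }
  have hρ : ∀ g : TT K v i 1 →ₗ[K] ExtE K v,
      ρ (g ∘ₗ Submodule.subtype _) = g ∘ₗ θ0 K v 0 i := fun _ => rfl
  have hfin : Module.Finite K (TT K v (i+1) 0) := by
    have : Module.Finite K (Symq K v 0) := Module.Finite.iff_fg.2 (homogeneousSubmodule_fg _ _ _)
    have : Module.Finite K (Wlin K v) := Module.Finite.iff_fg.2 (homogeneousSubmodule_fg _ _ _)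
    infer_instance
  refine ⟨τ' ∘ₗ ρ, ?_, ?_⟩
  · refine le_antisymm ?_ ?_
    · rintro _ ⟨f, rfl⟩
      rw [LinearMap.comp_apply, ← hk_sum K v (Module.finBasis K (TT K v (i+1) 0)) (ρ f), map_sum]
      refine Submodule.sum_mem _ fun j _ => ?_
      rw [map_smul]
      exact Submodule.smul_mem _ _ (Submodule.subset_span (hτ'.I1 _))
    · refine Submodule.span_le.2 fun y hy => ?_
      obtain ⟨φ, rfl⟩ := hτ'.I2 y hy
      obtain ⟨g, hg⟩ := hkF2z K v i (hk1 K v φ)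
      exact ⟨g ∘ₗ Submodule.subtype _, by rw [LinearMap.comp_apply, hρ, hg]⟩
  · ext f
    rw [LinearMap.mem_ker, LinearMap.mem_range, LinearMap.comp_apply]
    constructor
    · intro hf
      obtain ⟨g, rfl⟩ := LinearMap.exists_extend f
      rw [hρ, h] at hf
      obtain ⟨b, hb⟩ := hτ.W g hf
      refine ⟨b ∘ₗ Submodule.subtype _, ?_⟩
      rw [dC_sub]
      exact ((hk_sub_iff K v i 0 _ _).2 hb).symm
    · rintro ⟨f', rfl⟩
      obtain ⟨g, rfl⟩ := LinearMap.exists_extend f'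
      rw [dC_sub, hρ, h, dBdB, map_zero]

theorem hk_mul_mem (e : ExtE K v) (m : Vdu K v) : e * ExteriorAlgebra.ι K m ∈
    (⨆ k : ℕ, (⋀[K]^(k+1) (Vdu K v) : Submodule K (ExtE K v))) := by
  induction e using DirectSum.Decomposition.inductionOn (fun k : ℕ => ⋀[K]^k (Vdu K v)) with
  | zero => rw [zero_mul]; exact Submodule.zero_mem _
  | @homogeneous k x =>
    refine Submodule.mem_iSup_of_mem k ?_
    change _ ∈ (LinearMap.range (ExteriorAlgebra.ι K (M := Vdu K v))) ^ (k+1)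
    rw [pow_succ]
    exact Submodule.mul_mem_mul x.2 ⟨_, rfl⟩
  | add x y hx hy => rw [add_mul]; exact Submodule.add_mem _ hx hy

theorem dC_smul (i l : ℕ) (e : ExtE K v) (φ : Module.Dual K (hkH K v i (l+1))) :
    dC K v i l (e • hk1 K v φ) = ∑ a, (e * ExteriorAlgebra.ι K (eV K v a)) •
      hk1 K v (φ ∘ₗ hkx K v a i l) := by
  refine LinearMap.ext fun t => ?_
  rw [dC_apply, LinearMap.sum_apply]
  refine Finset.sum_congr rfl fun a _ => ?_
  simp only [LinearMap.smul_apply, hk1_apply, LinearMap.comp_apply, smul_eq_mul, mul_assoc]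
  rw [Algebra.commutes]

theorem hk_min {N : Type} [AddCommGroup N] [Module K N] [Module (ExtE K v) N] (i l : ℕ)
    (g : (hkH K v i l →ₗ[K] ExtE K v) →ₗ[ExtE K v] N) (e : ExtE K v)
    (φ : Module.Dual K (hkH K v i (l+1))) : g (dC K v i l (e • hk1 K v φ)) ∈ mSmul K v N := by
  rw [dC_smul, map_sum]
  refine Submodule.sum_mem _ fun a _ => ?_
  rw [map_smul]
  exact Submodule.subset_span ⟨_, _, hk_mul_mem K v e _, rfl⟩

theorem hk_transport {R : Type*} [Ring R] (A B : ℕ → Type) [∀ l, AddCommGroup (A l)]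
    [∀ l, AddCommGroup (B l)] [∀ l, Module R (A l)] [∀ l, Module R (B l)]
    (Φ : ∀ l, A l ≃ₗ[R] B l) (D : ∀ l, B (l+1) →ₗ[R] B l) {M : Type} [AddCommGroup M] [Module R M]
    (I : Submodule R M) (ε0 : B 0 →ₗ[R] M) (hr : LinearMap.range ε0 = I)
    (hk : LinearMap.ker ε0 = LinearMap.range (D 0))
    (hD : ∀ l, LinearMap.ker (D l) = LinearMap.range (D (l+1))) :
    ∃ (d : ∀ l, A (l+1) →ₗ[R] A l) (ε : A 0 →ₗ[R] I), Function.Surjective ε ∧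
      LinearMap.ker ε = LinearMap.range (d 0) ∧
      (∀ l, LinearMap.ker (d l) = LinearMap.range (d (l+1))) ∧
      ∀ l x, d l x = (Φ l).symm (D l (Φ (l+1) x)) := by
  have hker : ∀ {N : Type} [AddCommGroup N] [Module R N] (l : ℕ) (f : B l →ₗ[R] N),
      LinearMap.ker f = LinearMap.range (D l) →
      ∀ x, f (Φ l x) = 0 ↔ ∃ y, (Φ l).symm (D l (Φ (l+1) y)) = x := by
    intro N _ _ l f hf x
    have : f (Φ l x) = 0 ↔ Φ l x ∈ LinearMap.range (D l) := by rw [← hf, LinearMap.mem_ker]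
    rw [this, LinearMap.mem_range]
    constructor
    · rintro ⟨y, hy⟩
      exact ⟨(Φ (l+1)).symm y, by
        rw [LinearEquiv.apply_symm_apply, hy, LinearEquiv.symm_apply_apply]⟩
    · rintro ⟨y, rfl⟩
      exact ⟨_, by rw [LinearEquiv.apply_symm_apply]⟩
  refine ⟨fun l => (Φ l).symm.toLinearMap ∘ₗ D l ∘ₗ (Φ (l+1)).toLinearMap,
    (ε0 ∘ₗ (Φ 0).toLinearMap).codRestrict _ (fun x => by rw [← hr]; exact ⟨_, rfl⟩),
    ?_, ?_, ?_, fun _ _ => rfl⟩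
  · rintro ⟨y, hy⟩
    rw [← hr] at hy
    obtain ⟨f, rfl⟩ := hy
    refine ⟨(Φ 0).symm f, Subtype.ext ?_⟩
    change ε0 (Φ 0 ((Φ 0).symm f)) = ε0 f
    rw [LinearEquiv.apply_symm_apply]
  · ext x
    rw [LinearMap.ker_codRestrict, LinearMap.mem_ker, LinearMap.mem_range]
    exact hker 0 ε0 hk x
  · intro l
    ext x
    rw [LinearMap.mem_ker, LinearMap.mem_range]
    have := hker (l+1) (D l) (hD l) x
    refine Iff.trans ?_ this
    exact (Φ l).symm.map_eq_zero_iff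

theorem hk_min2 (i l : ℕ) [Module.Finite K (hkH K v i (l+1))]
    {N : Type} [AddCommGroup N] [Module K N] [Module (ExtE K v) N]
    (g : (hkH K v i l →ₗ[K] ExtE K v) →ₗ[ExtE K v] N)
    (x : ExtE K v ⊗[K] Module.Dual K (hkH K v i (l+1))) :
    g (dC K v i l (hkΦ K v (hkH K v i (l+1)) x)) ∈ mSmul K v N := by
  induction x using TensorProduct.induction_on with
  | zero => rw [map_zero, map_zero, map_zero]; exact Submodule.zero_mem _
  | add x y hx hy => rw [map_add, map_add, map_add]; exact Submodule.add_mem _ hx hy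
  | tmul e φ => exact hk_min K v i l g e φ

set_option maxHeartbeats 4000000 in
theorem hk_final (i : ℕ) :
    ∃ (d : ∀ ℓ : ℕ,
        ((ExtE K v) ⊗[K] Module.Dual K ↥(LinearMap.range (θ0 K v (ℓ+1) i))) →ₗ[ExtE K v]
        ((ExtE K v) ⊗[K] Module.Dual K ↥(LinearMap.range (θ0 K v ℓ i))))
      (ε : ((ExtE K v) ⊗[K] Module.Dual K ↥(LinearMap.range (θ0 K v 0 i))) →ₗ[ExtE K v]
        ↥(mPow K v (i+1))),
      Function.Surjective ε ∧
      LinearMap.ker ε = LinearMap.range (d 0) ∧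
      (∀ ℓ : ℕ, LinearMap.ker (d ℓ) = LinearMap.range (d (ℓ+1))) ∧
      (∀ (ℓ : ℕ) x, d ℓ x ∈ mSmul K v _) := by
  obtain ⟨ε0, hr, hk⟩ := hk_aug K v i
  have hfinS : ∀ q, Module.Finite K (Symq K v q) :=
    fun q => Module.Finite.iff_fg.2 (homogeneousSubmodule_fg _ _ _)
  have hfin : ∀ l, Module.Finite K (hkH K v i l) := fun l => inferInstance
  obtain ⟨d, ε, h1, h2, h3, h4⟩ := hk_transport
    (fun l => ExtE K v ⊗[K] Module.Dual K (hkH K v i l)) (fun l => hkH K v i l →ₗ[K] ExtE K v)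
    (fun l => hkΦ K v (hkH K v i l)) (dC K v i) (mPow K v (i+1)) ε0 hr hk (dC_exact K v i)
  refine ⟨d, ε, h1, h2, h3, fun l x => ?_⟩
  rw [h4]
  exact hk_min2 K v i l (hkΦ K v (hkH K v i l)).symm.toLinearMap x

end hkH

set_option maxHeartbeats 4000000

/-!
STATEMENT 12: For `i > 0` the minimal free resolution of `𝔪^i` over `E = ⋀ V`
(`dim_K V = v`) has `ℓ`-th term `E ⊗_K (⋀^i_{ℓ+1} W)^*`, where
`⋀^i_j W = im (⋀^i W ⊗ Sym_{j-1} W → ⋀^{i-1} W ⊗ Sym_j W)` is the hook Schur module.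
Below `θ q p : ⋀^{p+1} W ⊗ Sym_q → ⋀^p W ⊗ Sym_{q+1}` is the Koszul contraction (so
`⋀^{i+1}_{ℓ+1} W = range (θ ℓ i)`), and the resolution is written as
`⋯ → E ⊗ (⋀^{i+1}_2 W)^* → E ⊗ (⋀^{i+1}_1 W)^* → 𝔪^{i+1} → 0` (exact), with all
differentials mapping into `𝔪` times the next term (minimality).
-/
theorem stmt_12 (i : ℕ)
    (θ : ∀ q p : ℕ, (↥(⋀[K]^(p+1) (Wlin K v)) ⊗[K] Symq K v q) →ₗ[K]
        (↥(⋀[K]^p (Wlin K v)) ⊗[K] Symq K v (q+1)))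
    (hθ : ∀ (q p : ℕ) (w : Fin (p+1) → Wlin K v) (s : Symq K v q),
      θ q p (wedgeEl K v (p+1) w ⊗ₜ s) =
        ∑ k : Fin (p+1), ((-1 : K)^(k : ℕ)) •
          (wedgeEl K v p (fun j => w (k.succAbove j)) ⊗ₜ symMul K v (w k) s)) :
    ∃ (d : ∀ ℓ : ℕ,
        ((ExtE K v) ⊗[K] Module.Dual K ↥(LinearMap.range (θ (ℓ+1) i))) →ₗ[ExtE K v]
        ((ExtE K v) ⊗[K] Module.Dual K ↥(LinearMap.range (θ ℓ i))))
      (ε : ((ExtE K v) ⊗[K] Module.Dual K ↥(LinearMap.range (θ 0 i))) →ₗ[ExtE K v]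
        ↥(mPow K v (i+1))),
      Function.Surjective ε ∧
      LinearMap.ker ε = LinearMap.range (d 0) ∧
      (∀ ℓ : ℕ, LinearMap.ker (d ℓ) = LinearMap.range (d (ℓ+1))) ∧
      (∀ (ℓ : ℕ) x, d ℓ x ∈ mSmul K v _) := by
  obtain rfl := θ_eq K v θ hθ
  exact hk_final K v i

end
end
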